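/- There exists a universal constant C > 0 with the following property. Let K ⊂ ℝⁿ be a centrally symmetric convex body of volume 1 which is 2-convex with constant α > 0, and suppose K is in John's maximal-volume ellipsoid position. Then (∫_K |x|² dx)^{1/2} ≤ (C/α)·√n, where |·| is the Euclidean norm. -/

import Mathlib

open MeasureTheory
open scoped RealInnerProductSpace

noncomputable section

/-- A centrally symmetric convex body: compact, convex, with nonempty interior,
and symmetric about the origin. -/
def IsSymmConvexBody {E : Type*} [NormedAddCommGroup E] [NormedSpace ℝ E]
    (K : Set E) : Prop :=
  IsCompact K ∧ Convex ℝ K ∧ (interior K).Nonempty ∧ K = -K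

/-- The modulus of convexity of `K`, defined via the gauge (Minkowski functional) of `K`. -/
def modulusOfConvexity {E : Type*} [AddCommGroup E] [Module ℝ E]
    (K : Set E) (ε : ℝ) : ℝ :=
  sInf { d | ∃ x y : E, gauge K x ≤ 1 ∧ gauge K y ≤ 1 ∧ ε ≤ gauge K (x - y) ∧
    d = 1 - gauge K ((2:ℝ)⁻¹ • (x + y)) }

/-- `K` is 2-convex with constant `α`: `δ_K(ε) ≥ α ε²` for all `0 < ε ≤ 2`. -/
def IsTwoConvex {E : Type*} [AddCommGroup E] [Module ℝ E]
    (K : Set E) (α : ℝ) : Prop :=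
  ∀ ε : ℝ, 0 < ε → ε ≤ 2 → α * ε ^ 2 ≤ modulusOfConvexity K ε

/-- An ellipsoid: the image of the Euclidean unit ball under an invertible linear map. -/
def IsEllipsoid {n : ℕ} (A : Set (EuclideanSpace ℝ (Fin n))) : Prop :=
  ∃ T : EuclideanSpace ℝ (Fin n) ≃ₗ[ℝ] EuclideanSpace ℝ (Fin n),
    A = T '' Metric.closedBall 0 1

/-- `K` is in John's maximal-volume ellipsoid position: some Euclidean ball `r·D_n ⊆ K`
has maximal volume among all ellipsoids contained in `K`. -/
def InJohnPosition {n : ℕ} (K : Set (EuclideanSpace ℝ (Fin n))) : Prop :=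
  ∃ r : ℝ, 0 < r ∧ Metric.closedBall (0 : EuclideanSpace ℝ (Fin n)) r ⊆ K ∧
    ∀ A : Set (EuclideanSpace ℝ (Fin n)), IsEllipsoid A → A ⊆ K →
      volume A ≤ volume (Metric.closedBall (0 : EuclideanSpace ℝ (Fin n)) r)

/-- `K` is in Löwner's minimal-volume outer ellipsoid position: some Euclidean ball
`R·D_n ⊇ K` has minimal volume among all ellipsoids containing `K`. -/
def InLownerPosition {n : ℕ} (K : Set (EuclideanSpace ℝ (Fin n))) : Prop :=
  ∃ R : ℝ, 0 < R ∧ K ⊆ Metric.closedBall (0 : EuclideanSpace ℝ (Fin n)) R ∧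
    ∀ A : Set (EuclideanSpace ℝ (Fin n)), IsEllipsoid A → K ⊆ A →
      volume (Metric.closedBall (0 : EuclideanSpace ℝ (Fin n)) R) ≤ volume A

section

open Set ENNReal

open scoped Pointwise

/-- One-dimensional Brunn–Minkowski inequality for compact sets. -/
theorem volume_add_volume_le_of_isCompact {A B C : Set ℝ} (hA : IsCompact A) (hB : IsCompact B)
    (hA₀ : A.Nonempty) (hB₀ : B.Nonempty)
    (h : ∀ a ∈ A, ∀ b ∈ B, (2⁻¹ : ℝ) * (a + b) ∈ C) :
    volume A + volume B ≤ 2 * volume C := by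
  obtain ⟨a, haA, ha⟩ := hA.exists_isGreatest hA₀
  obtain ⟨b, hbB, hb⟩ := hB.exists_isLeast hB₀
  have hvol : ∀ (S : Set ℝ) (c : ℝ),
      volume ((fun x ↦ (2⁻¹ : ℝ) * (x + c)) ⁻¹' S) = 2 * volume S := by
    intro S c
    have : (fun x ↦ (2⁻¹ : ℝ) * (x + c)) ⁻¹' S =
        (fun x ↦ x + c) ⁻¹' ((fun x ↦ (2⁻¹ : ℝ) * x) ⁻¹' S) :=
      rfl
    rw [this, measure_preimage_add_right, Real.volume_preimage_mul_left (by norm_num)]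
    norm_num
  set m : ℝ := 2⁻¹ * (a + b) with hm
  have h1 : A ⊆ (fun x ↦ (2⁻¹ : ℝ) * (x + b)) ⁻¹' (C ∩ Iic m) := fun x hx ↦
    ⟨h x hx b hbB, by have := ha hx; simp only [mem_Iic, hm]; linarith⟩
  have h2 : B \ {b} ⊆ (fun x ↦ (2⁻¹ : ℝ) * (x + a)) ⁻¹' (C \ Iic m) := fun x hx ↦
    ⟨by simpa [add_comm] using h a haA x hx.1, by
      have := lt_of_le_of_ne (hb hx.1) (Ne.symm hx.2)
      simp only [mem_Iic, hm, not_le]; linarith⟩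
  calc volume A + volume B = volume A + volume (B \ {b}) := by
        rw [measure_sdiff_null (by simp)]
    _ ≤ 2 * volume (C ∩ Iic m) + 2 * volume (C \ Iic m) := by
        rw [← hvol _ b, ← hvol _ a]; gcongr
    _ = 2 * volume C := by rw [← mul_add, measure_inter_add_sdiff _ measurableSet_Iic]

/-- One-dimensional Brunn–Minkowski inequality for measurable sets. -/
theorem volume_add_volume_le {A B C : Set ℝ} (hA : MeasurableSet A) (hB : MeasurableSet B)
    (hA₀ : A.Nonempty) (hB₀ : B.Nonempty)
    (h : ∀ a ∈ A, ∀ b ∈ B, (2⁻¹ : ℝ) * (a + b) ∈ C) :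
    volume A + volume B ≤ 2 * volume C := by
  obtain ⟨a, ha⟩ := hA₀
  obtain ⟨b, hb⟩ := hB₀
  have key : ∀ K ⊆ A, IsCompact K → ∀ L ⊆ B, IsCompact L → volume K + volume L ≤ 2 * volume C := by
    intro K hK hKc L hL hLc
    calc volume K + volume L ≤ volume (insert a K) + volume (insert b L) := by
          gcongr <;> exact subset_insert _ _
      _ ≤ _ := volume_add_volume_le_of_isCompact (hKc.insert a) (hLc.insert b)
          (insert_nonempty _ _) (insert_nonempty _ _) fun x hx y hy ↦
            h x (insert_subset ha hK hx) y (insert_subset hb hL hy)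
  rw [hA.measure_eq_iSup_isCompact, hB.measure_eq_iSup_isCompact]
  simp only [iSup_and']
  exact ENNReal.biSup_add_biSup_le' ⟨∅, empty_subset _, isCompact_empty⟩
    ⟨∅, empty_subset _, isCompact_empty⟩ fun K hK L hL ↦ key K hK.1 hK.2 L hL.1 hL.2

/-- Prékopa–Leindler on the line for functions with supremum one. -/
theorem lintegral_add_le_of_sup_one {f g h : ℝ → ℝ≥0∞} (hf : Measurable f) (hg : Measurable g)
    (hh : Measurable h) (hf1 : ∀ x, f x ≤ 1) (hg1 : ∀ x, g x ≤ 1)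
    (hf0 : ∀ t < 1, ∃ x, t < f x) (hg0 : ∀ t < 1, ∃ x, t < g x)
    (H : ∀ x y, f x * g y ≤ h (2⁻¹ * (x + y)) ^ 2) :
    (∫⁻ x, f x) + ∫⁻ x, g x ≤ 2 * ∫⁻ x, h x := by
  have key : ∀ φ : ℝ → ℝ≥0∞, Measurable φ → (∀ x, φ x ≤ 1) →
      ∫⁻ x, φ x = ∫⁻ t in Ioi (0:ℝ), volume {x | ENNReal.ofReal t < φ x} := by
    intro φ hφ hφ1
    have hfin : ∀ x, φ x ≠ ∞ := fun x ↦ ((hφ1 x).trans_lt one_lt_top).ne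
    have := lintegral_eq_lintegral_meas_lt volume (f := fun x ↦ (φ x).toReal)
      (.of_forall fun x ↦ toReal_nonneg) hφ.ennreal_toReal.aemeasurable
    simp only [ofReal_toReal (hfin _)] at this
    rw [this]
    refine setLIntegral_congr_fun measurableSet_Ioi fun t ht ↦ ?_
    simp only [ofReal_lt_iff_lt_toReal (le_of_lt ht) (hfin _)]
  have hmin : ∫⁻ x, min (h x) 1 ≤ ∫⁻ x, h x := lintegral_mono fun x ↦ min_le_left _ _
  refine le_trans ?_ (mul_le_mul_right hmin 2)
  rw [key f hf hf1, key g hg hg1, key _ (hh.min measurable_const) fun x ↦ min_le_right _ _]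
  refine (le_lintegral_add _ _).trans ?_
  rw [← lintegral_const_mul' _ _ (by simp)]
  refine setLIntegral_mono' measurableSet_Ioi fun t ht ↦ ?_
  rcases lt_or_ge (ENNReal.ofReal t) 1 with h1 | h1
  · refine volume_add_volume_le (measurableSet_lt measurable_const hf)
      (measurableSet_lt measurable_const hg) (hf0 _ h1) (hg0 _ h1) fun x hx y hy ↦ ?_
    refine lt_min ?_ h1
    by_contra! hc
    have : ENNReal.ofReal t ^ 2 < f x * g y := by
      rw [sq]; exact ENNReal.mul_lt_mul hx hy
    exact absurd ((this.trans_le (H x y)).trans_le (pow_le_pow_left' hc 2)) (lt_irrefl _)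
  · have : ∀ φ : ℝ → ℝ≥0∞, (∀ x, φ x ≤ 1) → {x | ENNReal.ofReal t < φ x} = ∅ := by
      intro φ hφ; ext x; simp [(hφ x).trans h1]
    simp [this f hf1, this g hg1]

theorem ENNReal.mul_le_sq_of_add_le {a b c : ℝ≥0∞} (h : a + b ≤ 2 * c) : a * b ≤ c ^ 2 := by
  by_cases hc : c = ∞
  · simp [hc]
  have h2 : 2 * c ≠ ∞ := mul_ne_top (by simp) hc
  have ha : a ≠ ∞ := (le_self_add.trans h).trans_lt h2.lt_top |>.ne
  have hb : b ≠ ∞ := (le_add_self.trans h).trans_lt h2.lt_top |>.ne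
  lift a to NNReal using ha
  lift b to NNReal using hb
  lift c to NNReal using hc
  norm_cast at h ⊢
  have h' : (a:ℝ) + b ≤ 2 * c := by exact_mod_cast h
  have : (a:ℝ) * b ≤ c ^ 2 := by
    nlinarith [sq_nonneg ((a:ℝ) - b), a.2, b.2, c.2, a.coe_nonneg, b.coe_nonneg, c.coe_nonneg]
  exact_mod_cast this

/-- Prékopa–Leindler on the line for bounded functions. -/
theorem prekopa_leindler_real_of_bounded {f g h : ℝ → ℝ≥0∞} (hf : Measurable f)
    (hg : Measurable g) (hh : Measurable h) {M : ℝ≥0∞} (hM : M ≠ ∞) (hfM : ∀ x, f x ≤ M)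
    (hgM : ∀ x, g x ≤ M) (H : ∀ x y, f x * g y ≤ h (2⁻¹ * (x + y)) ^ 2) :
    (∫⁻ x, f x) * (∫⁻ x, g x) ≤ (∫⁻ x, h x) ^ 2 := by
  set a := ⨆ x, f x with ha
  set b := ⨆ x, g x with hb
  have ha' : a ≠ ∞ := ((iSup_le hfM).trans_lt hM.lt_top).ne
  have hb' : b ≠ ∞ := ((iSup_le hgM).trans_lt hM.lt_top).ne
  have hfa : ∀ x, f x ≤ a := le_iSup f
  have hgb : ∀ x, g x ≤ b := le_iSup g
  rcases eq_or_ne a 0 with ha0 | ha0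
  · have : ∀ x, f x = 0 := fun x ↦ le_zero_iff.1 (ha0 ▸ hfa x)
    simp [this]
  rcases eq_or_ne b 0 with hb0 | hb0
  · have : ∀ x, g x = 0 := fun x ↦ le_zero_iff.1 (hb0 ▸ hgb x)
    simp [this]
  obtain ⟨c, hc⟩ : ∃ c : ℝ≥0∞, c ^ 2 = a * b := ⟨(a * b) ^ (2⁻¹ : ℝ), by
    rw [← rpow_natCast, ← rpow_mul]; norm_num⟩
  have hab : a * b ≠ 0 := mul_ne_zero ha0 hb0
  have hab' : a * b ≠ ∞ := mul_ne_top ha' hb'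
  have hsup : ∀ (φ : ℝ → ℝ≥0∞) (s : ℝ≥0∞), s = ⨆ x, φ x → s ≠ 0 → s ≠ ∞ →
      ∀ t < 1, ∃ x, t < s⁻¹ * φ x := by
    intro φ s hs hs0 hs1 t ht
    have : t * s < ⨆ x, φ x := by
      rw [← hs]; simpa using ENNReal.mul_lt_mul_left hs0 hs1 ht
    obtain ⟨x, hx⟩ := lt_iSup_iff.1 this
    refine ⟨x, ?_⟩
    rwa [mul_comm, ← div_eq_mul_inv, ENNReal.lt_div_iff_mul_lt (.inl hs0) (.inl hs1)]
  have hle : ∀ s y : ℝ≥0∞, s ≠ 0 → s ≠ ∞ → y ≤ s → s⁻¹ * y ≤ 1 := by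
    intro s y hs hs' hy
    rw [← ENNReal.inv_mul_cancel hs hs']; gcongr
  have := lintegral_add_le_of_sup_one (f := fun x ↦ a⁻¹ * f x) (g := fun x ↦ b⁻¹ * g x)
    (h := fun x ↦ c⁻¹ * h x) (hf.const_mul _) (hg.const_mul _) (hh.const_mul _)
    (fun x ↦ hle _ _ ha0 ha' (hfa x)) (fun x ↦ hle _ _ hb0 hb' (hgb x)) (hsup f a ha ha0 ha')
    (hsup g b hb hb0 hb') fun x y ↦ by
      rw [mul_pow, ← ENNReal.inv_pow, hc, ENNReal.mul_inv (.inl ha0) (.inl ha'), mul_mul_mul_comm]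
      gcongr
      exact H x y
  rw [lintegral_const_mul _ hf, lintegral_const_mul _ hg, lintegral_const_mul _ hh] at this
  have h3 := ENNReal.mul_le_sq_of_add_le this
  rw [mul_pow, ← ENNReal.inv_pow, hc, mul_mul_mul_comm,
    ← ENNReal.mul_inv (.inl ha0) (.inl ha')] at h3
  have := mul_le_mul_right h3 (a * b)
  rwa [← mul_assoc, ENNReal.mul_inv_cancel hab hab', one_mul, ← mul_assoc,
    ENNReal.mul_inv_cancel hab hab', one_mul] at this

theorem lintegral_eq_iSup_min_natCast {α : Type*} [MeasurableSpace α] {μ : Measure α}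
    {f : α → ℝ≥0∞} (hf : Measurable f) : ∫⁻ x, f x ∂μ = ⨆ N : ℕ, ∫⁻ x, min (f x) N ∂μ := by
  rw [← lintegral_iSup (fun N ↦ hf.min measurable_const)
    fun i j hij x ↦ min_le_min_left _ (by exact_mod_cast hij)]
  congr 1 with x
  have : (⨆ N : ℕ, min (f x) (N : ℝ≥0∞)) = min (f x) (⨆ N : ℕ, (N : ℝ≥0∞)) :=
    inf_iSup_eq _ _ |>.symm
  rw [this, ENNReal.iSup_natCast, min_eq_left le_top]

theorem prekopa_leindler_real {f g h : ℝ → ℝ≥0∞} (hf : Measurable f)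
    (hg : Measurable g) (hh : Measurable h) (H : ∀ x y, f x * g y ≤ h (2⁻¹ * (x + y)) ^ 2) :
    (∫⁻ x, f x) * (∫⁻ x, g x) ≤ (∫⁻ x, h x) ^ 2 := by
  rw [lintegral_eq_iSup_min_natCast hf, lintegral_eq_iSup_min_natCast hg, ENNReal.iSup_mul]
  refine iSup_le fun N ↦ ?_
  rw [ENNReal.mul_iSup]
  refine iSup_le fun M ↦ ?_
  refine prekopa_leindler_real_of_bounded (hf.min measurable_const) (hg.min measurable_const) hh
    (M := max N M) (by simp) (fun x ↦ (min_le_right _ _).trans (le_max_left _ _))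
    (fun x ↦ (min_le_right _ _).trans (le_max_right _ _)) fun x y ↦ (H x y).trans' ?_
  gcongr <;> exact min_le_left _ _

/-- The Prékopa–Leindler inequality for midpoints. -/
theorem prekopa_leindler {n : ℕ} {f g h : (Fin n → ℝ) → ℝ≥0∞} (hf : Measurable f)
    (hg : Measurable g) (hh : Measurable h)
    (H : ∀ x y, f x * g y ≤ h ((2⁻¹ : ℝ) • (x + y)) ^ 2) :
    (∫⁻ x, f x) * (∫⁻ x, g x) ≤ (∫⁻ x, h x) ^ 2 := by
  induction n with
  | zero =>
    rw [volume_pi, Measure.pi_of_empty _ isEmptyElim, lintegral_dirac, lintegral_dirac,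
      lintegral_dirac]
    simpa [Subsingleton.elim _ (isEmptyElim : Fin 0 → ℝ)] using H isEmptyElim isEmptyElim
  | succ n ih =>
    let e := MeasurableEquiv.piFinSuccAbove (fun _ : Fin (n + 1) ↦ ℝ) 0
    have he : MeasurePreserving e.symm :=
      (volume_preserving_piFinSuccAbove (fun _ : Fin (n + 1) ↦ ℝ) 0).symm _
    have hlin : ∀ (s t : ℝ) (x y : Fin n → ℝ), e.symm (2⁻¹ * (s + t), (2⁻¹ : ℝ) • (x + y)) =
        (2⁻¹ : ℝ) • (e.symm (s, x) + e.symm (t, y)) := by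
      intro s t x y
      ext i
      refine Fin.cases ?_ (fun i ↦ ?_) i <;> simp [e, MeasurableEquiv.piFinSuccAbove, mul_add]
    have fub : ∀ φ : (Fin (n + 1) → ℝ) → ℝ≥0∞, Measurable φ →
        ∫⁻ x, φ x = ∫⁻ t, ∫⁻ x, φ (e.symm (t, x)) := by
      intro φ hφ
      rw [← he.lintegral_comp hφ, Measure.volume_eq_prod,
        lintegral_prod (fun p ↦ φ (e.symm p)) (hφ.comp e.symm.measurable).aemeasurable]
    have hm : ∀ φ : (Fin (n + 1) → ℝ) → ℝ≥0∞, Measurable φ →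
        Measurable fun p : ℝ × (Fin n → ℝ) ↦ φ (e.symm p) := fun φ hφ ↦
      hφ.comp e.symm.measurable
    rw [fub f hf, fub g hg, fub h hh]
    refine prekopa_leindler_real (hm f hf).lintegral_prod_right' (hm g hg).lintegral_prod_right'
      (hm h hh).lintegral_prod_right' fun s t ↦ ?_
    refine ih ((hm f hf).comp measurable_prodMk_left) ((hm g hg).comp measurable_prodMk_left)
      ((hm h hh).comp measurable_prodMk_left) fun x y ↦ ?_
    simp only [hlin]
    exact H _ _

/-- The multiplicative Brunn–Minkowski inequality for midpoints. -/
theorem volume_mul_volume_le_sq {n : ℕ} {A B C : Set (EuclideanSpace ℝ (Fin n))}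
    (hA : MeasurableSet A) (hB : MeasurableSet B) (hC : MeasurableSet C)
    (H : ∀ x ∈ A, ∀ y ∈ B, (2⁻¹ : ℝ) • (x + y) ∈ C) :
    volume A * volume B ≤ volume C ^ 2 := by
  have hT := PiLp.volume_preserving_toLp (Fin n)
  have hm : ∀ S : Set (EuclideanSpace ℝ (Fin n)), MeasurableSet S →
      volume S = ∫⁻ x, (WithLp.toLp 2 ⁻¹' S).indicator 1 x := by
    intro S hS
    rw [lintegral_indicator_one (hT.measurable hS), hT.measure_preimage hS.nullMeasurableSet]
  rw [hm A hA, hm B hB, hm C hC]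
  refine prekopa_leindler (measurable_one.indicator (hT.measurable hA))
    (measurable_one.indicator (hT.measurable hB)) (measurable_one.indicator (hT.measurable hC))
    fun x y ↦ ?_
  by_cases hx : WithLp.toLp 2 x ∈ A
  · by_cases hy : WithLp.toLp 2 y ∈ B
    · have := H _ hx _ hy
      have h' : (2⁻¹ : ℝ) • (x + y) ∈ (WithLp.toLp 2 ⁻¹' C) := by simpa using this
      rw [indicator_of_mem h']
      simp only [Pi.one_apply, one_pow]
      exact mul_le_one' (indicator_le_self' (by simp) x |>.trans le_rfl)
        (indicator_le_self' (by simp) y)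
    · rw [indicator_of_notMem (s := WithLp.toLp 2 ⁻¹' B) hy]; simp
  · rw [indicator_of_notMem (s := WithLp.toLp 2 ⁻¹' A) hx]; simp

section Gauge

variable {E : Type*} [NormedAddCommGroup E] [NormedSpace ℝ E] {K : Set E}

theorem IsSymmConvexBody.zero_mem_interior (hK : IsSymmConvexBody K) : (0 : E) ∈ interior K := by
  obtain ⟨-, hc, ⟨x, hx⟩, hs⟩ := hK
  have hx' : -x ∈ interior K := by
    rw [hs]
    change -x ∈ interior (Homeomorph.neg E ⁻¹' K)
    rw [← Homeomorph.preimage_interior]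
    simpa using hx
  simpa using hc.interior.midpoint_mem hx hx'

theorem IsSymmConvexBody.mem_nhds_zero (hK : IsSymmConvexBody K) : K ∈ nhds (0 : E) :=
  mem_interior_iff_mem_nhds.1 hK.zero_mem_interior

theorem IsSymmConvexBody.neg_mem (hK : IsSymmConvexBody K) {x : E} (hx : x ∈ K) : -x ∈ K := by
  rw [hK.2.2.2]; simpa using hx

theorem IsSymmConvexBody.gauge_le_one_iff (hK : IsSymmConvexBody K) {x : E} :
    gauge K x ≤ 1 ↔ x ∈ K := by
  rw [gauge_le_one_iff_mem_closure hK.2.1 hK.mem_nhds_zero, hK.1.isClosed.closure_eq]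

theorem IsSymmConvexBody.gauge_pos (hK : IsSymmConvexBody K) {x : E} (hx : x ≠ 0) :
    0 < gauge K x :=
  (_root_.gauge_pos (absorbent_nhds_zero hK.mem_nhds_zero)
    (NormedSpace.isVonNBounded_of_isBounded ℝ hK.1.isBounded)).2 hx

theorem IsSymmConvexBody.inv_gauge_smul_mem (hK : IsSymmConvexBody K) (x : E) :
    (gauge K x)⁻¹ • x ∈ K := by
  rw [← hK.gauge_le_one_iff, gauge_smul_of_nonneg (inv_nonneg.2 (gauge_nonneg x)), smul_eq_mul]
  exact inv_mul_le_one

theorem IsSymmConvexBody.mem_smul_of_gauge_le (hK : IsSymmConvexBody K) {x : E} {a : ℝ}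
    (hx : gauge K x ≤ a) : x ∈ a • K := by
  rcases eq_or_ne x 0 with rfl | hx0
  · exact ⟨0, interior_subset hK.zero_mem_interior, smul_zero a⟩
  have ha : 0 < a := (hK.gauge_pos hx0).trans_le hx
  refine (mem_smul_set_iff_inv_smul_mem₀ ha.ne' _ _).2 ?_
  rw [← hK.gauge_le_one_iff, gauge_smul_of_nonneg (inv_nonneg.2 ha.le), smul_eq_mul]
  exact inv_mul_le_one_of_le₀ hx ha.le

theorem IsSymmConvexBody.gauge_midpoint_le (hK : IsSymmConvexBody K) {x y : E}
    (hx : gauge K x ≤ 1) (hy : gauge K y ≤ 1) : gauge K ((2 : ℝ)⁻¹ • (x + y)) ≤ 1 := by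
  have := gauge_add_le hK.2.1 (absorbent_nhds_zero hK.mem_nhds_zero) x y
  rw [gauge_smul_of_nonneg (by norm_num), smul_eq_mul]
  linarith

theorem IsSymmConvexBody.modulusOfConvexity_le (hK : IsSymmConvexBody K) {x y : E} {ε : ℝ}
    (hx : gauge K x ≤ 1) (hy : gauge K y ≤ 1) (hε : ε ≤ gauge K (x - y)) :
    modulusOfConvexity K ε ≤ 1 - gauge K ((2 : ℝ)⁻¹ • (x + y)) := by
  refine csInf_le ⟨0, ?_⟩ ⟨x, y, hx, hy, hε, rfl⟩
  rintro _ ⟨x, y, hx, hy, -, rfl⟩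
  linarith [hK.gauge_midpoint_le hx hy]

theorem IsTwoConvex.gauge_midpoint_le {α : ℝ} (hα : IsTwoConvex K α) (hK : IsSymmConvexBody K)
    {x y : E} (hx : x ∈ K) (hy : y ∈ K) {ε : ℝ} (hε₀ : 0 < ε) (hε : ε ≤ gauge K (x - y)) :
    gauge K ((2 : ℝ)⁻¹ • (x + y)) ≤ 1 - α * ε ^ 2 := by
  have hx' := hK.gauge_le_one_iff.2 hx
  have hy' := hK.gauge_le_one_iff.2 (hK.neg_mem hy)
  have h2 := gauge_add_le hK.2.1 (absorbent_nhds_zero hK.mem_nhds_zero) x (-y)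
  rw [← sub_eq_add_neg] at h2
  have h3 := hα ε hε₀ (by linarith)
  have h4 := hK.modulusOfConvexity_le hx' (hK.gauge_le_one_iff.2 hy) hε
  linarith

theorem IsTwoConvex.le_quarter [Nontrivial E] {α : ℝ} (hα : IsTwoConvex K α)
    (hK : IsSymmConvexBody K) : α ≤ 1 / 4 := by
  obtain ⟨x, hx⟩ := exists_ne (0 : E)
  have hg := hK.gauge_pos hx
  set y := (gauge K x)⁻¹ • x with hy
  have hyK : y ∈ K := hK.inv_gauge_smul_mem x
  have h2 : gauge K (y - -y) = 2 := by
    rw [sub_neg_eq_add, ← two_smul ℝ y, hy, gauge_smul_of_nonneg (by norm_num),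
      gauge_smul_of_nonneg (inv_nonneg.2 hg.le), smul_eq_mul, smul_eq_mul,
      inv_mul_cancel₀ hg.ne', mul_one]
  have := hα.gauge_midpoint_le hK hyK (hK.neg_mem hyK) two_pos h2.ge
  have h0 := gauge_nonneg (s := K) ((2 : ℝ)⁻¹ • (y + -y))
  linarith

end Gauge

section Moment

variable {n : ℕ} {K : Set (EuclideanSpace ℝ (Fin n))} {α s : ℝ} {u : EuclideanSpace ℝ (Fin n)}

theorem IsSymmConvexBody.inner_le_mul_gauge (hK : IsSymmConvexBody K)
    (hs : ∀ x ∈ K, ⟪u, x⟫ ≤ s) (x : EuclideanSpace ℝ (Fin n)) : ⟪u, x⟫ ≤ s * gauge K x := by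
  rcases eq_or_ne x 0 with rfl | hx
  · simp
  have hg := hK.gauge_pos hx
  have := hs _ (hK.inv_gauge_smul_mem x)
  rw [inner_smul_right, inv_mul_le_iff₀ hg] at this
  linarith

/-- Half-spaces at distance from the origin cut off an exponentially small part of a
2-convex body. -/
theorem IsTwoConvex.volume_cap_le (hα : IsTwoConvex K α) (hK : IsSymmConvexBody K)
    (hvol : volume K = 1) (hs₀ : 0 < s) (hs : ∀ x ∈ K, ⟪u, x⟫ ≤ s)
    {t : ℝ} (ht : 0 < t) :
    volume (K ∩ {x | t ≤ ⟪u, x⟫}) ≤ ENNReal.ofReal (Real.exp (-(4 * n * α / s ^ 2 * t ^ 2))) := by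
  set A := K ∩ {x | t ≤ ⟪u, x⟫} with hA
  rcases A.eq_empty_or_nonempty with h0 | ⟨x₀, hx₀⟩
  · simp [h0]
  have hAm : MeasurableSet A := hK.1.measurableSet.inter
    (isClosed_le continuous_const (by fun_prop)).measurableSet
  set a : ℝ := 1 - α * (2 * t / s) ^ 2 with ha
  have key : ∀ x ∈ A, ∀ y ∈ -A, gauge K ((2 : ℝ)⁻¹ • (x + y)) ≤ a := by
    rintro x ⟨hxK, hx⟩ y ⟨hyK, hy⟩
    refine hα.gauge_midpoint_le hK hxK (by simpa using hK.neg_mem hyK) (by positivity) ?_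
    rw [div_le_iff₀ hs₀]
    have := hK.inner_le_mul_gauge hs (x - y)
    simp only [mem_ofPred_eq, inner_neg_right] at hx hy
    rw [inner_sub_right] at this
    linarith
  have ha₀ : 0 ≤ a := (gauge_nonneg _).trans (key x₀ hx₀ (-x₀) (by simpa using hx₀))
  have hBM := volume_mul_volume_le_sq hAm hAm.neg (hK.1.smul a).measurableSet
    fun x hx y hy ↦ hK.mem_smul_of_gauge_le (key x hx y hy)
  rw [Measure.measure_neg, ← sq, Measure.addHaar_smul, hvol, mul_one, finrank_euclideanSpace_fin,
    abs_of_nonneg (by positivity)] at hBM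
  refine ((ENNReal.pow_le_pow_left_iff two_ne_zero).1 hBM).trans (ENNReal.ofReal_le_ofReal ?_)
  calc a ^ n ≤ Real.exp (-(α * (2 * t / s) ^ 2)) ^ n := by
        gcongr
        linarith [Real.add_one_le_exp (-(α * (2 * t / s) ^ 2))]
    _ = _ := by
        rw [← Real.exp_nat_mul]
        congr 1
        field_simp
        ring

theorem IsTwoConvex.setIntegral_inner_sq_le (hα : IsTwoConvex K α) (hα₀ : 0 < α) (hn : 0 < n)
    (hK : IsSymmConvexBody K) (hvol : volume K = 1) (hs₀ : 0 < s) (hs : ∀ x ∈ K, ⟪u, x⟫ ≤ s) :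
    2 * α * n * ∫ x in K, ⟪u, x⟫ ^ 2 ≤ s ^ 2 := by
  set β : ℝ := 4 * n * α / s ^ 2 with hβ
  have hn' : (0 : ℝ) < n := by exact_mod_cast hn
  have hβ₀ : 0 < β := by positivity
  have hI : ∫ τ in Ioi (0 : ℝ), 2 * Real.exp (-β * τ) = 2 / β := by
    rw [integral_const_mul, integral_exp_mul_Ioi (by linarith)]
    simp
    field_simp
  have hint : IntegrableOn (fun τ ↦ 2 * Real.exp (-β * τ)) (Ioi 0) :=
    (integrableOn_exp_mul_Ioi (by linarith) 0).const_mul 2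
  have hle : ∫⁻ x in K, ENNReal.ofReal (⟪u, x⟫ ^ 2) ≤ ENNReal.ofReal (2 / β) := by
    rw [lintegral_eq_lintegral_meas_le _ (.of_forall fun x ↦ sq_nonneg _)
      (by fun_prop), ← hI, ofReal_integral_eq_lintegral_ofReal hint
      (.of_forall fun x ↦ by positivity)]
    refine setLIntegral_mono' measurableSet_Ioi fun τ hτ ↦ ?_
    have hτ' : 0 < τ := hτ
    rw [Measure.restrict_apply' hK.1.measurableSet]
    have hsub : {x | τ ≤ ⟪u, x⟫ ^ 2} ∩ K ⊆
        (K ∩ {x | √τ ≤ ⟪u, x⟫}) ∪ -(K ∩ {x | √τ ≤ ⟪u, x⟫}) := by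
      rintro x ⟨hx, hxK⟩
      rcases le_abs.1 (Real.sqrt_le_sqrt hx |>.trans_eq (Real.sqrt_sq_eq_abs _)) with h | h
      · exact .inl ⟨hxK, h⟩
      · exact .inr ⟨hK.neg_mem hxK, by simpa using h⟩
    refine (measure_mono hsub).trans ((measure_union_le _ _).trans ?_)
    rw [Measure.measure_neg, ← two_mul, ENNReal.ofReal_mul zero_le_two]
    have := hα.volume_cap_le hK hvol hs₀ hs (Real.sqrt_pos.2 hτ')
    rw [Real.sq_sqrt hτ'.le, ← neg_mul] at this
    simpa using mul_le_mul_right this 2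
  have hfin : ∫ x in K, ⟪u, x⟫ ^ 2 ≤ 2 / β := by
    rw [integral_eq_lintegral_of_nonneg_ae (.of_forall fun x ↦ sq_nonneg _)
      (by fun_prop)]
    exact ENNReal.toReal_le_of_le_ofReal (by positivity) hle
  calc 2 * α * n * ∫ x in K, ⟪u, x⟫ ^ 2 ≤ 2 * α * n * (2 / β) := by gcongr
    _ = s ^ 2 := by rw [hβ]; field_simp; norm_num

end Moment

section John

open Matrix

open scoped MatrixOrder in
theorem Matrix.PosSemidef.exists_eq_transpose_mul_self {n : ℕ} {N : Matrix (Fin n) (Fin n) ℝ}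
    (hN : N.PosSemidef) : ∃ B : Matrix (Fin n) (Fin n) ℝ, N = Bᵀ * B := by
  obtain ⟨B, hB⟩ := CStarAlgebra.nonneg_iff_eq_star_mul_self.1 hN.nonneg
  exact ⟨B, by simpa [Matrix.star_eq_conjTranspose] using hB⟩

/-- A direction along which the determinant does not increase at the identity has nonpositive
trace. -/
theorem Matrix.trace_nonpos_of_det_one_add_smul_le {n : ℕ} (B : Matrix (Fin n) (Fin n) ℝ)
    (h : ∀ t ∈ Ioo (0 : ℝ) 1, (1 + t • B).det ≤ 1) : B.trace ≤ 0 := by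
  set P := (det (1 + (Polynomial.X : Polynomial ℝ) • B.map Polynomial.C)).divX.divX with hP
  have hlim : Filter.Tendsto (fun t : ℝ ↦ -(P.eval t * t)) (nhdsWithin 0 (Ioi 0)) (nhds 0) := by
    have : Continuous fun t : ℝ ↦ -(P.eval t * t) := by fun_prop
    simpa using (this.tendsto 0).mono_left nhdsWithin_le_nhds
  refine ge_of_tendsto hlim ?_
  filter_upwards [Ioo_mem_nhdsGT (zero_lt_one' ℝ)] with t ht
  have h1 := h t ht
  rw [det_one_add_smul, ← hP] at h1
  have : t * (B.trace + P.eval t * t) ≤ 0 := by linarith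
  have := nonpos_of_mul_nonpos_right this ht.1
  linarith

variable {n : ℕ} {K : Set (EuclideanSpace ℝ (Fin n))} {r : ℝ}

/-- If the support function of the ellipsoid given by `N` is dominated by that of `K`, then the
volume of this ellipsoid is at most that of the maximal ball. -/
theorem det_le_of_isMaximal_closedBall (hc : Convex ℝ K) (hcl : IsClosed K) (hr : 0 ≤ r)
    (hmax : ∀ A : Set (EuclideanSpace ℝ (Fin n)), IsEllipsoid A → A ⊆ K →
      volume A ≤ volume (Metric.closedBall (0 : EuclideanSpace ℝ (Fin n)) r))
    (hK₀ : (0 : EuclideanSpace ℝ (Fin n)) ∈ K)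
    {N : Matrix (Fin n) (Fin n) ℝ} (hN : N.PosSemidef)
    (hNK : ∀ (u : EuclideanSpace ℝ (Fin n)) (s : ℝ), 0 < s → (∀ x ∈ K, ⟪u, x⟫ ≤ s) →
      u.ofLp ⬝ᵥ N *ᵥ u.ofLp ≤ s ^ 2) :
    N.det ≤ (r ^ n) ^ 2 := by
  obtain ⟨B, rfl⟩ := hN.exists_eq_transpose_mul_self
  rw [det_mul, det_transpose, ← sq]
  rcases eq_or_ne B.det 0 with h0 | h0
  · rw [h0, zero_pow two_ne_zero]; positivity
  set T : EuclideanSpace ℝ (Fin n) →ₗ[ℝ] EuclideanSpace ℝ (Fin n) := toLpLin 2 2 Bᵀ with hT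
  have hdet : LinearMap.det T = B.det := by
    rw [hT, toLpLin_eq_toLin, LinearMap.det_toLin, det_transpose]
  have hsub : T '' Metric.closedBall 0 1 ⊆ K := by
    rintro _ ⟨v, hv, rfl⟩
    by_contra hnot
    obtain ⟨f, s, hfs, hfv⟩ := geometric_hahn_banach_closed_point hc hcl hnot
    set u := (InnerProductSpace.toDual ℝ (EuclideanSpace ℝ (Fin n))).symm f with hu
    have hf : ∀ x, f x = ⟪u, x⟫ := fun x ↦ by rw [hu, InnerProductSpace.toDual_symm_apply]
    have hs : 0 < s := by simpa using hfs 0 hK₀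
    have h1 := hNK u s hs fun x hx ↦ (hf x ▸ hfs x hx).le
    set w : EuclideanSpace ℝ (Fin n) := WithLp.toLp 2 (B *ᵥ u.ofLp) with hw
    have hwn : ‖w‖ ^ 2 = u.ofLp ⬝ᵥ (Bᵀ * B) *ᵥ u.ofLp := by
      rw [← real_inner_self_eq_norm_sq, EuclideanSpace.inner_eq_star_dotProduct, star_trivial, hw,
        ← mulVec_mulVec, dotProduct_mulVec u.ofLp, vecMul_transpose]
    have huv : ⟪u, T v⟫ = ⟪w, v⟫ := by
      simp only [EuclideanSpace.inner_eq_star_dotProduct, star_trivial, hw, hT, toLpLin_apply]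
      rw [dotProduct_comm, dotProduct_mulVec, vecMul_transpose, dotProduct_comm]
    have hws : ‖w‖ ≤ s := abs_le_of_sq_le_sq' (hwn ▸ h1) hs.le |>.2
    have h2 : ⟪w, v⟫ ≤ ‖w‖ * 1 := (real_inner_le_norm w v).trans
      (mul_le_mul_of_nonneg_left (by simpa using hv) (norm_nonneg w))
    rw [hf, huv] at hfv
    linarith
  have hvol := hmax (T '' Metric.closedBall 0 1)
    ⟨T.equivOfDetNeZero (by rwa [hdet]), rfl⟩ hsub
  rw [Measure.addHaar_image_linearMap, hdet, Measure.addHaar_closedBall _ _ hr,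
    Measure.addHaar_closedBall _ _ zero_le_one, one_pow, ofReal_one, one_mul,
    finrank_euclideanSpace_fin,
    ENNReal.mul_le_mul_iff_left (Metric.measure_ball_pos _ _ one_pos).ne' measure_ball_lt_top.ne,
    ENNReal.ofReal_le_ofReal_iff (by positivity)] at hvol
  rw [← sq_abs]
  gcongr

/-- In John's position, a quadratic form dominated by the squared support function has trace at
most `n` times the squared radius of the maximal ball. -/
theorem trace_le_of_isMaximal_closedBall (hc : Convex ℝ K) (hcl : IsClosed K) (hr : 0 < r)
    (hball : Metric.closedBall (0 : EuclideanSpace ℝ (Fin n)) r ⊆ K)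
    (hmax : ∀ A : Set (EuclideanSpace ℝ (Fin n)), IsEllipsoid A → A ⊆ K →
      volume A ≤ volume (Metric.closedBall (0 : EuclideanSpace ℝ (Fin n)) r))
    {M : Matrix (Fin n) (Fin n) ℝ} (hM : M.PosSemidef)
    (hMK : ∀ (u : EuclideanSpace ℝ (Fin n)) (s : ℝ), 0 < s → (∀ x ∈ K, ⟪u, x⟫ ≤ s) →
      u.ofLp ⬝ᵥ M *ᵥ u.ofLp ≤ s ^ 2) :
    M.trace ≤ n * r ^ 2 := by
  have hballK : ∀ (u : EuclideanSpace ℝ (Fin n)) (s : ℝ), 0 < s → (∀ x ∈ K, ⟪u, x⟫ ≤ s) →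
      r ^ 2 * (u.ofLp ⬝ᵥ u.ofLp) ≤ s ^ 2 := by
    intro u s hs hu
    have huu : u.ofLp ⬝ᵥ u.ofLp = ‖u‖ ^ 2 := by
      rw [← real_inner_self_eq_norm_sq, EuclideanSpace.inner_eq_star_dotProduct, star_trivial]
    rw [huu, ← mul_pow]
    rcases eq_or_ne u 0 with rfl | hu0
    · simp; positivity
    have hpos : 0 < ‖u‖ := norm_pos_iff.2 hu0
    have := hu ((r / ‖u‖) • u) (hball (by
      rw [mem_closedBall_zero_iff, norm_smul, norm_div, norm_norm, Real.norm_of_nonneg hr.le,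
        div_mul_cancel₀ _ hpos.ne']))
    rw [inner_smul_right, real_inner_self_eq_norm_sq] at this
    have h' : r * ‖u‖ ≤ s := by
      calc r * ‖u‖ = r / ‖u‖ * ‖u‖ ^ 2 := by field_simp
        _ ≤ s := this
    gcongr
  have hmain := Matrix.trace_nonpos_of_det_one_add_smul_le ((r ^ 2)⁻¹ • M - 1) fun t ht ↦ by
    have heq : ((1 - t) * r ^ 2) • (1 : Matrix (Fin n) (Fin n) ℝ) + t • M =
        r ^ 2 • (1 + t • ((r ^ 2)⁻¹ • M - 1)) := by
      rw [smul_add, smul_sub, smul_sub, smul_comm t, smul_smul, mul_inv_cancel₀ (by positivity),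
        one_smul]
      module
    have hdet := det_le_of_isMaximal_closedBall (N := ((1 - t) * r ^ 2) • 1 + t • M) hc hcl hr.le
      hmax (hball (by simp [hr.le])) ((PosSemidef.one.smul (by
        have := ht.2; have : 0 < 1 - t := by linarith
        positivity)).add (hM.smul ht.1.le)) fun u s hs hu ↦ by
        have h1 := mul_le_mul_of_nonneg_left (hballK u s hs hu) (sub_nonneg.2 ht.2.le)
        have h2 := mul_le_mul_of_nonneg_left (hMK u s hs hu) ht.1.le
        rw [add_mulVec, smul_mulVec, smul_mulVec, one_mulVec, dotProduct_add, dotProduct_smul,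
          dotProduct_smul, smul_eq_mul, smul_eq_mul]
        linarith
    rw [heq, det_smul, Fintype.card_fin, ← pow_mul, ← pow_mul, mul_comm n 2] at hdet
    have : 0 < r ^ (2 * n) := by positivity
    exact le_of_mul_le_mul_left (by simpa using hdet) this
  rw [trace_sub, trace_smul, trace_one, Fintype.card_fin, smul_eq_mul, sub_nonpos,
    inv_mul_le_iff₀ (by positivity)] at hmain
  linarith

theorem sq_radius_le_of_volume_closedBall_le_one (hn : 0 < n) (hr : 0 ≤ r)
    (h : volume (Metric.closedBall (0 : EuclideanSpace ℝ (Fin n)) r) ≤ 1) :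
    4 * r ^ 2 ≤ n := by
  have hn' : (0 : ℝ) < n := by exact_mod_cast hn
  have hT := PiLp.volume_preserving_toLp (Fin n)
  have hsub : Metric.closedBall (0 : Fin n → ℝ) (r / √n) ⊆
      WithLp.toLp 2 ⁻¹' Metric.closedBall (0 : EuclideanSpace ℝ (Fin n)) r := by
    intro x hx
    rw [mem_closedBall_zero_iff] at hx
    rw [mem_preimage, mem_closedBall_zero_iff]
    refine abs_le_of_sq_le_sq' ?_ hr |>.2
    rw [EuclideanSpace.real_norm_sq_eq]
    calc ∑ i, x i ^ 2 ≤ ∑ _i : Fin n, (r / √n) ^ 2 := by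
          refine Finset.sum_le_sum fun i _ ↦ ?_
          rw [← sq_abs]
          have := (norm_le_pi_norm x i).trans hx
          rw [Real.norm_eq_abs] at this
          gcongr
      _ = r ^ 2 := by
          rw [Finset.sum_const, Finset.card_univ, Fintype.card_fin, nsmul_eq_mul, div_pow,
            Real.sq_sqrt hn'.le]
          field_simp
  have h1 := measure_mono (μ := volume) hsub
  rw [hT.measure_preimage measurableSet_closedBall.nullMeasurableSet,
    Real.volume_pi_closedBall _ (by positivity), Fintype.card_fin] at h1
  have h2 : (2 * (r / √n)) ^ n ≤ 1 := by
    rw [← ENNReal.ofReal_le_one]; exact h1.trans h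
  have h3 : 2 * (r / √n) ≤ 1 := (pow_le_one_iff_of_nonneg (by positivity) hn.ne').1 h2
  have h4 : 2 * r ≤ √n := by
    rw [← mul_div_assoc, div_le_one (by positivity)] at h3; exact h3
  calc 4 * r ^ 2 = (2 * r) ^ 2 := by ring
    _ ≤ √n ^ 2 := by gcongr
    _ = n := Real.sq_sqrt hn'.le

end John

section SecondMoment

open Matrix

variable {n : ℕ} {K : Set (EuclideanSpace ℝ (Fin n))}

/-- The matrix of second moments of a set. -/
def secondMomentMatrix (K : Set (EuclideanSpace ℝ (Fin n))) : Matrix (Fin n) (Fin n) ℝ :=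
  .of fun i j ↦ ∫ x in K, x i * x j

theorem dotProduct_secondMomentMatrix_mulVec (hK : IsCompact K) (u : EuclideanSpace ℝ (Fin n)) :
    u.ofLp ⬝ᵥ secondMomentMatrix K *ᵥ u.ofLp = ∫ x in K, ⟪u, x⟫ ^ 2 := by
  have hint : ∀ i j, IntegrableOn (fun x : EuclideanSpace ℝ (Fin n) ↦ u i * (x i * x j * u j)) K :=
    fun i j ↦ ContinuousOn.integrableOn_compact hK (by fun_prop)
  have : ∀ x : EuclideanSpace ℝ (Fin n), ⟪u, x⟫ ^ 2 = ∑ i, ∑ j, u i * (x i * x j * u j) := by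
    intro x
    rw [sq, PiLp.inner_apply, Finset.sum_mul_sum]
    refine Finset.sum_congr rfl fun i _ ↦ Finset.sum_congr rfl fun j _ ↦ ?_
    simp
    ring
  simp only [this]
  rw [integral_finsetSum _ fun i _ ↦ integrable_finsetSum _ fun j _ ↦ hint i j]
  simp only [dotProduct, mulVec, Finset.mul_sum]
  refine Finset.sum_congr rfl fun i _ ↦ ?_
  rw [integral_finsetSum _ fun j _ ↦ hint i j]
  refine Finset.sum_congr rfl fun j _ ↦ ?_
  rw [integral_const_mul, integral_mul_const]
  rfl

theorem posSemidef_secondMomentMatrix (hK : IsCompact K) : (secondMomentMatrix K).PosSemidef := by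
  refine .of_dotProduct_mulVec_nonneg ?_ fun u ↦ ?_
  · ext i j
    simp [secondMomentMatrix, mul_comm]
  · rw [star_trivial]
    exact (dotProduct_secondMomentMatrix_mulVec hK (WithLp.toLp 2 u)).symm ▸
      integral_nonneg fun x ↦ sq_nonneg _

theorem trace_secondMomentMatrix (hK : IsCompact K) :
    (secondMomentMatrix K).trace = ∫ x in K, ‖x‖ ^ 2 := by
  simp only [EuclideanSpace.real_norm_sq_eq]
  rw [integral_finsetSum _ fun i _ ↦ ContinuousOn.integrableOn_compact hK (by fun_prop)]
  simp [Matrix.trace, secondMomentMatrix, sq]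

end SecondMoment

end

theorem twoConvex_john_position_essentially_isotropic :
    ∃ C : ℝ, 0 < C ∧ ∀ (n : ℕ) (K : Set (EuclideanSpace ℝ (Fin n))) (α : ℝ),
      0 < n → IsSymmConvexBody K → volume K = 1 → 0 < α → IsTwoConvex K α →
      InJohnPosition K →
      Real.sqrt (∫ x in K, ‖x‖ ^ 2) ≤ (C / α) * Real.sqrt n := by
  refine ⟨1, one_pos, fun n K α hn hK hvol hα₀ hα ⟨r, hr, hball, hmax⟩ ↦ ?_⟩
  have hn' : (0 : ℝ) < n := by exact_mod_cast hn
  have : NeZero n := ⟨hn.ne'⟩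
  have hα4 := hα.le_quarter hK
  have hr2 : 4 * r ^ 2 ≤ n :=
    sq_radius_le_of_volume_closedBall_le_one hn hr.le ((measure_mono hball).trans hvol.le)
  have htr := trace_le_of_isMaximal_closedBall hK.2.1 hK.1.isClosed hr hball hmax
    (M := (2 * α * n) • secondMomentMatrix K)
    ((posSemidef_secondMomentMatrix hK.1).smul (by positivity)) fun u s hs hu ↦ by
      rw [Matrix.smul_mulVec, dotProduct_smul, dotProduct_secondMomentMatrix_mulVec hK.1,
        smul_eq_mul]
      exact hα.setIntegral_inner_sq_le hα₀ hn hK hvol hs hu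
  rw [Matrix.trace_smul, trace_secondMomentMatrix hK.1, smul_eq_mul] at htr
  set I := ∫ x in K, ‖x‖ ^ 2 with hI
  have h1 : 2 * α * I ≤ r ^ 2 := le_of_mul_le_mul_left (by linarith) hn'
  refine Real.sqrt_le_iff.2 ⟨by positivity, ?_⟩
  rw [mul_pow, Real.sq_sqrt hn'.le, div_pow, one_pow, one_div_mul_eq_div,
    le_div_iff₀ (by positivity)]
  calc I * α ^ 2 = α * (α * I) := by ring
    _ ≤ 1 / 4 * (n / 8) := by
      gcongr
      · linarith
    _ ≤ n := by linarith
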